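/- Fix square matrices A_1, …, A_J ∈ M^{n×n} over ℝ. Let Q_1, …, Q_J be independent random n × n matrices each distributed according to the Haar probability measure on the orthogonal group O(n), and let G_1, …, G_J be independent n × n random matrices with independent N(0, 1/n) entries. Then for every nonnegative, positively homogeneous, convex function |·| on M^{n×n} and every weakly increasing convex function Φ : ℝ → ℝ, one has E Φ(| Σ_{j=1}^J Q_j A_j |) ≤ E Φ(1.5·| Σ_{j=1}^J G_j A_j |). -/

import Mathlib

open MeasureTheory ProbabilityTheory Matrix

/-- The space of `n × n` real matrices carries the product measurable structure. -/
instance matrixMeasurableSpace (n k : ℕ) : MeasurableSpace (Matrix (Fin n) (Fin k) ℝ) :=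
  MeasurableSpace.pi

instance Matrix.borelSpace_fin (n k : ℕ) : BorelSpace (Matrix (Fin n) (Fin k) ℝ) :=
  inferInstanceAs (BorelSpace (Fin n → Fin k → ℝ))

theorem Measurable.matrix_of_entries {α : Type*} [MeasurableSpace α] {n k : ℕ}
    {f : α → Matrix (Fin n) (Fin k) ℝ} (h : ∀ i j, Measurable fun x => f x i j) :
    Measurable f :=
  measurable_pi_iff.2 fun i => measurable_pi_iff.2 fun j => h i j

theorem Measurable.matrix_entry {α : Type*} [MeasurableSpace α] {n k : ℕ}
    {f : α → Matrix (Fin n) (Fin k) ℝ} (h : Measurable f) (i : Fin n) (j : Fin k) :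
    Measurable fun x => f x i j :=
  measurable_pi_iff.1 (measurable_pi_iff.1 h i) j

@[fun_prop]
theorem Measurable.matrix_mul {α : Type*} [MeasurableSpace α] {n k l : ℕ}
    {f : α → Matrix (Fin n) (Fin k) ℝ} {g : α → Matrix (Fin k) (Fin l) ℝ}
    (hf : Measurable f) (hg : Measurable g) : Measurable fun x => f x * g x := by
  refine Measurable.matrix_of_entries fun i j => ?_
  simp only [Matrix.mul_apply]
  exact Finset.measurable_fun_sum _ fun m _ => (hf.matrix_entry i m).mul (hg.matrix_entry m j)

@[fun_prop]
theorem Measurable.matrix_transpose {α : Type*} [MeasurableSpace α] {n k : ℕ}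
    {f : α → Matrix (Fin n) (Fin k) ℝ} (hf : Measurable f) : Measurable fun x => (f x)ᵀ :=
  Measurable.matrix_of_entries fun i j => hf.matrix_entry j i

/-- A left-invariant probability measure supported on the orthogonal group is right-invariant. -/
theorem lintegral_mul_right_of_left_invariant {n : ℕ} {μ : Measure (Matrix (Fin n) (Fin n) ℝ)}
    [IsProbabilityMeasure μ] (h_orth : ∀ᵐ Q ∂μ, Qᵀ * Q = 1)
    (h_inv : ∀ U : Matrix (Fin n) (Fin n) ℝ, Uᵀ * U = 1 → μ.map (fun Q => U * Q) = μ)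
    {f : Matrix (Fin n) (Fin n) ℝ → ENNReal} (hf : Measurable f)
    {U : Matrix (Fin n) (Fin n) ℝ} (hU : Uᵀ * U = 1) :
    ∫⁻ Q, f (Q * U) ∂μ = ∫⁻ Q, f Q ∂μ := by
  have left : ∀ (g : Matrix (Fin n) (Fin n) ℝ → ENNReal), Measurable g →
      ∀ V : Matrix (Fin n) (Fin n) ℝ, Vᵀ * V = 1 → ∫⁻ Q, g (V * Q) ∂μ = ∫⁻ Q, g Q ∂μ := by
    intro g hg V hV
    conv_rhs => rw [← h_inv V hV]
    rw [lintegral_map hg (by fun_prop)]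
  have key : ∀ g : Matrix (Fin n) (Fin n) ℝ → ENNReal, Measurable g →
      ∫⁻ Q, g Qᵀ ∂μ = ∫⁻ Q, g Q ∂μ := by
    intro g hg
    have h1 : ∫⁻ P, ∫⁻ Q, g (Pᵀ * Q) ∂μ ∂μ = ∫⁻ Q, g Q ∂μ := by
      have : ∀ᵐ P ∂μ, ∫⁻ Q, g (Pᵀ * Q) ∂μ = ∫⁻ Q, g Q ∂μ := by
        filter_upwards [h_orth] with P hP
        exact left g hg _ (by rw [transpose_transpose]; exact mul_eq_one_comm.1 hP)
      rw [lintegral_congr_ae this]; simp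
    have h2 : ∫⁻ Q, ∫⁻ P, g (Pᵀ * Q) ∂μ ∂μ = ∫⁻ Q, g Qᵀ ∂μ := by
      have : ∀ᵐ Q ∂μ, ∫⁻ P, g (Pᵀ * Q) ∂μ = ∫⁻ P, g Pᵀ ∂μ := by
        filter_upwards [h_orth] with Q hQ
        have := left (fun P => g Pᵀ) (by fun_prop) Qᵀ
          (by rw [transpose_transpose]; exact mul_eq_one_comm.1 hQ)
        simpa only [transpose_mul, transpose_transpose] using this
      rw [lintegral_congr_ae this]; simp
    rw [← h1, ← h2, lintegral_lintegral_swap]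
    exact Measurable.aemeasurable (by unfold Function.uncurry; fun_prop)
  have h3 := left (fun P => f Pᵀ) (by fun_prop) Uᵀ
    (by rw [transpose_transpose]; exact mul_eq_one_comm.1 hU)
  simp only [transpose_mul, transpose_transpose] at h3
  rw [← key f hf, ← h3]
  exact (key (fun Q => f (Q * U)) (by fun_prop)).symm

/-- The law of an `n × n` matrix with independent centred Gaussian entries of variance `v`. -/
noncomputable def gaussianMatrix (n : ℕ) (v : NNReal) : Measure (Matrix (Fin n) (Fin n) ℝ) :=
  Measure.pi fun _ : Fin n => Measure.pi fun _ : Fin n => gaussianReal 0 v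

instance (n : ℕ) (v : NNReal) : IsProbabilityMeasure (gaussianMatrix n v) :=
  inferInstanceAs (IsProbabilityMeasure
    (Measure.pi fun _ : Fin n => Measure.pi fun _ : Fin n => gaussianReal 0 v))

theorem integral_gaussianMatrix_prod {𝕜 : Type*} [RCLike 𝕜] {n : ℕ} {v : NNReal}
    (f : Fin n → Fin n → ℝ → 𝕜) :
    ∫ G, ∏ i, ∏ k, f i k (G i k) ∂(gaussianMatrix n v) =
      ∏ i, ∏ k, ∫ x, f i k x ∂(gaussianReal 0 v) := by
  have h := integral_fintype_prod_eq_prod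
    (μ := fun _ : Fin n => Measure.pi fun _ : Fin n => gaussianReal 0 v)
    (fun (i : Fin n) (r : Fin n → ℝ) => ∏ k, f i k (r k))
  refine h.trans (Finset.prod_congr rfl fun i _ => ?_)
  exact integral_fintype_prod_eq_prod (fun (k : Fin n) => f i k)

theorem integrable_gaussianMatrix_prod {𝕜 : Type*} [NormedCommRing 𝕜] {n : ℕ} {v : NNReal}
    {f : Fin n → Fin n → ℝ → 𝕜} (hf : ∀ i k, Integrable (f i k) (gaussianReal 0 v)) :
    Integrable (fun G : Matrix (Fin n) (Fin n) ℝ => ∏ i, ∏ k, f i k (G i k))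
      (gaussianMatrix n v) := by
  refine Integrable.fintype_prod (f := fun (i : Fin n) (r : Fin n → ℝ) => ∏ k, f i k (r k))
    fun i => ?_
  exact Integrable.fintype_prod (f := fun k => f i k) (hf i)

/-- The array with a single unit entry at position `(i, k)`. -/
def unitArray {n : ℕ} (i k : Fin n) : Fin n → Fin n → ℝ := Pi.single i (Pi.single k 1)

theorem map_eq_sum_unitArray {n : ℕ} (L : (Fin n → Fin n → ℝ) →ₗ[ℝ] ℝ) (G : Fin n → Fin n → ℝ) :
    L G = ∑ i, ∑ k, L (unitArray i k) * G i k := by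
  have hG : G = ∑ i, ∑ k, G i k • unitArray i k := by
    ext a b
    simp [unitArray, Finset.sum_apply, Pi.single_apply, ite_apply]
  refine (congrArg L hG).trans ?_
  simp only [map_sum, map_smul, smul_eq_mul]
  exact Finset.sum_congr rfl fun i _ => Finset.sum_congr rfl fun k _ => mul_comm _ _

theorem charFunDual_pi_pi_gaussianReal {n : ℕ} {v : NNReal}
    (L : StrongDual ℝ (Fin n → Fin n → ℝ)) :
    charFunDual (Measure.pi fun _ : Fin n => Measure.pi fun _ : Fin n => gaussianReal 0 v) L =
      Complex.exp (-(v * ∑ i, ∑ k, (L (unitArray i k)) ^ 2 : ℝ) / 2) := by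
  have hL : ∀ G : Fin n → Fin n → ℝ, L G = ∑ i, ∑ k, L (unitArray i k) * G i k :=
    map_eq_sum_unitArray L.toLinearMap
  rw [charFunDual_apply]
  have hexp : ∀ G : Fin n → Fin n → ℝ, Complex.exp (L G * Complex.I) =
      ∏ i, ∏ k, Complex.exp ((L (unitArray i k) * G i k : ℝ) * Complex.I) := by
    intro G
    rw [hL G]
    simp only [Complex.ofReal_sum, Finset.sum_mul, Complex.exp_sum]
  rw [integral_congr_ae (Filter.Eventually.of_forall hexp)]
  refine (integral_gaussianMatrix_prod (v := v) (fun i k x =>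
    Complex.exp ((L (unitArray i k) * x : ℝ) * Complex.I))).trans ?_
  have : ∀ t : ℝ, ∫ x, Complex.exp ((t * x : ℝ) * Complex.I) ∂(gaussianReal 0 v) =
      Complex.exp (-(v * t ^ 2) / 2) := by
    intro t
    have := charFun_gaussianReal (μ := 0) (v := v) t
    rw [charFun_apply_real] at this
    push_cast
    rw [this]
    congr 1
    push_cast; ring
  simp_rw [this, ← Complex.exp_sum]
  congr 1
  push_cast
  simp_rw [Finset.mul_sum, ← Finset.sum_neg_distrib, Finset.sum_div]

theorem map_pi_pi_gaussianReal_of_dual {n : ℕ} {v : NNReal}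
    (T : (Fin n → Fin n → ℝ) →ₗ[ℝ] (Fin n → Fin n → ℝ))
    (hT : ∀ L : (Fin n → Fin n → ℝ) →ₗ[ℝ] ℝ,
      ∑ i, ∑ k, (L (T (unitArray i k))) ^ 2 = ∑ i, ∑ k, (L (unitArray i k)) ^ 2) :
    (Measure.pi fun _ : Fin n => Measure.pi fun _ : Fin n => gaussianReal 0 v).map T =
      Measure.pi fun _ : Fin n => Measure.pi fun _ : Fin n => gaussianReal 0 v := by
  change Measure.map (LinearMap.toContinuousLinearMap T) _ = _
  apply Measure.ext_of_charFunDual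
  ext L
  rw [charFunDual_map, charFunDual_pi_pi_gaussianReal, charFunDual_pi_pi_gaussianReal]
  congr 5
  exact hT L.toLinearMap

theorem sum_sq_mulVec_of_orthogonal {n : ℕ} {U : Matrix (Fin n) (Fin n) ℝ} (hU : Uᵀ * U = 1)
    (x : Fin n → ℝ) : ∑ i, (∑ j, U i j * x j) ^ 2 = ∑ i, x i ^ 2 := by
  have h : (U *ᵥ x) ⬝ᵥ (U *ᵥ x) = x ⬝ᵥ x := by
    rw [Matrix.dotProduct_mulVec, ← Matrix.mulVec_transpose, Matrix.mulVec_mulVec, hU,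
      Matrix.one_mulVec]
  simpa only [dotProduct, mulVec, ← pow_two] using h

theorem map_gaussianMatrix_mul_left {n : ℕ} {v : NNReal} {U : Matrix (Fin n) (Fin n) ℝ}
    (hU : Uᵀ * U = 1) : (gaussianMatrix n v).map (fun G => U * G) = gaussianMatrix n v := by
  suffices hT : ∀ L : (Fin n → Fin n → ℝ) →ₗ[ℝ] ℝ,
      ∑ i, ∑ k, (L (LinearMap.mulLeft ℝ U (unitArray i k))) ^ 2 =
        ∑ i, ∑ k, (L (unitArray i k)) ^ 2 from
    map_pi_pi_gaussianReal_of_dual (v := v) (LinearMap.mulLeft ℝ U : Matrix (Fin n) (Fin n) ℝ →ₗ[ℝ] _) hT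
  intro L
  have h : ∀ i k, L (LinearMap.mulLeft ℝ U (unitArray i k)) =
      ∑ j, Uᵀ i j * L (unitArray j k) := by
    intro i k
    have : (LinearMap.mulLeft ℝ U (unitArray i k)) =
        (∑ j, Uᵀ i j • unitArray j k : Fin n → Fin n → ℝ) := by
      ext a b
      refine (Matrix.mul_apply (M := U) (N := unitArray i k)).trans ?_
      simp [Finset.sum_apply, unitArray, Pi.single_apply, ite_apply]
    refine (congrArg L this).trans ?_
    simp only [map_sum, map_smul, smul_eq_mul]
  simp only [h]
  rw [Finset.sum_comm]
  conv_rhs => rw [Finset.sum_comm]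
  exact Finset.sum_congr rfl fun k _ => sum_sq_mulVec_of_orthogonal
    (by rw [transpose_transpose]; exact mul_eq_one_comm.1 hU) _

theorem map_gaussianMatrix_mul_right {n : ℕ} {v : NNReal} {U : Matrix (Fin n) (Fin n) ℝ}
    (hU : Uᵀ * U = 1) : (gaussianMatrix n v).map (fun G => G * U) = gaussianMatrix n v := by
  suffices hT : ∀ L : (Fin n → Fin n → ℝ) →ₗ[ℝ] ℝ,
      ∑ i, ∑ k, (L (LinearMap.mulRight ℝ U (unitArray i k))) ^ 2 =
        ∑ i, ∑ k, (L (unitArray i k)) ^ 2 from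
    map_pi_pi_gaussianReal_of_dual (v := v) (LinearMap.mulRight ℝ U : Matrix (Fin n) (Fin n) ℝ →ₗ[ℝ] _) hT
  intro L
  have h : ∀ i k, L (LinearMap.mulRight ℝ U (unitArray i k)) =
      ∑ j, U k j * L (unitArray i j) := by
    intro i k
    have : (LinearMap.mulRight ℝ U (unitArray i k)) =
        (∑ j, U k j • unitArray i j : Fin n → Fin n → ℝ) := by
      ext a b
      refine (Matrix.mul_apply (M := unitArray i k) (N := U)).trans ?_
      simp [Finset.sum_apply, unitArray, Pi.single_apply, ite_apply]
    refine (congrArg L this).trans ?_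
    simp only [map_sum, map_smul, smul_eq_mul]
  simp only [h]
  exact Finset.sum_congr rfl fun i _ => sum_sq_mulVec_of_orthogonal hU _

theorem integral_rpow_abs_mul_exp_neg_mul_sq {B q : ℝ} (hB : 0 < B) (hq : -1 < q) :
    ∫ x : ℝ, |x| ^ q * Real.exp (-B * x ^ 2) =
      B ^ (-(q + 1) / 2) * Real.Gamma ((q + 1) / 2) := by
  have h1 := integral_comp_abs (f := fun x : ℝ => x ^ q * Real.exp (-B * x ^ (2 : ℝ)))
  have h2 := integral_rpow_mul_exp_neg_mul_rpow (p := 2) (q := q) (b := B) (by norm_num) hq hB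
  rw [h2] at h1
  simp only [Real.rpow_two, sq_abs] at h1
  rw [h1]; ring

theorem integral_gaussianReal_mul_exp {v : NNReal} (hv : v ≠ 0) (b : ℝ) (f : ℝ → ℝ) :
    ∫ x, f x * Real.exp (-b * x ^ 2) ∂(gaussianReal 0 v) =
      (Real.sqrt (2 * Real.pi * v))⁻¹ *
        ∫ x, f x * Real.exp (-(b + 1 / (2 * v)) * x ^ 2) := by
  rw [integral_gaussianReal_eq_integral_smul hv, ← integral_const_mul]
  refine integral_congr_ae (Filter.Eventually.of_forall fun x => ?_)
  simp only [gaussianPDFReal, smul_eq_mul, sub_zero]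
  have : Real.exp (-(b + 1 / (2 * v)) * x ^ 2) =
      Real.exp (-x ^ 2 / (2 * v)) * Real.exp (-b * x ^ 2) := by
    rw [← Real.exp_add]; congr 1; ring
  rw [this]; ring

theorem inv_sqrt_mul_rpow_mul_sqrt_pi {v : NNReal} (hv : v ≠ 0) {b z : ℝ} (hz : 0 < z)
    (hzb : z ^ 2 = 1 + 2 * b * v) :
    (Real.sqrt (2 * Real.pi * v))⁻¹ * ((b + 1 / (2 * v)) ^ (-(1 : ℝ) / 2) * Real.sqrt Real.pi) =
      z⁻¹ := by
  have hv' : (0 : ℝ) < v := by positivity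
  have hB : b + 1 / (2 * v) = z ^ 2 / (2 * v) := by rw [hzb]; field_simp; ring
  rw [hB, neg_div, Real.rpow_neg (by positivity), ← Real.sqrt_eq_rpow, Real.sqrt_div (by positivity),
    Real.sqrt_sq hz.le, show 2 * Real.pi * (v : ℝ) = (2 * v) * Real.pi by ring,
    Real.sqrt_mul (by positivity)]
  field_simp

theorem integral_gaussianReal_exp_neg_sq {v : NNReal} (hv : v ≠ 0) {b z : ℝ} (hz : 0 < z)
    (hzb : z ^ 2 = 1 + 2 * b * v) :
    ∫ x, Real.exp (-b * x ^ 2) ∂(gaussianReal 0 v) = z⁻¹ := by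
  have hv' : (0 : ℝ) < v := by positivity
  have hB : b + 1 / (2 * v) = z ^ 2 / (2 * v) := by rw [hzb]; field_simp; ring
  have h := integral_gaussianReal_mul_exp hv b fun _ => 1
  simp only [one_mul] at h
  have h0 := integral_rpow_abs_mul_exp_neg_mul_sq (B := b + 1 / (2 * v)) (q := 0)
    (by rw [hB]; positivity) (by norm_num)
  simp only [Real.rpow_zero, one_mul, zero_add, Real.Gamma_one_half_eq] at h0
  rw [h, h0, inv_sqrt_mul_rpow_mul_sqrt_pi hv hz hzb]

theorem integral_gaussianReal_id_mul_exp_neg_sq {v : NNReal} (hv : v ≠ 0) {b : ℝ} :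
    ∫ x, x * Real.exp (-b * x ^ 2) ∂(gaussianReal 0 v) = 0 := by
  rw [integral_gaussianReal_mul_exp hv b fun x => x]
  have h := integral_neg_eq_self (fun x : ℝ => x * Real.exp (-(b + 1 / (2 * v)) * x ^ 2)) volume
  simp only [neg_mul, neg_sq, integral_neg] at h ⊢
  rw [show (∫ x : ℝ, x * Real.exp (-((b + 1 / (2 * v)) * x ^ 2))) = 0 by linarith, mul_zero]

theorem integral_gaussianReal_sq_mul_exp_neg_sq {v : NNReal} (hv : v ≠ 0) {b z : ℝ} (hz : 0 < z)
    (hzb : z ^ 2 = 1 + 2 * b * v) :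
    ∫ x, x ^ 2 * Real.exp (-b * x ^ 2) ∂(gaussianReal 0 v) = z⁻¹ * (v / z ^ 2) := by
  have hv' : (0 : ℝ) < v := by positivity
  have hB : b + 1 / (2 * v) = z ^ 2 / (2 * v) := by rw [hzb]; field_simp; ring
  have hBpos : 0 < b + 1 / (2 * v) := by rw [hB]; positivity
  rw [integral_gaussianReal_mul_exp hv b fun x => x ^ 2]
  have h0 := integral_rpow_abs_mul_exp_neg_mul_sq (q := 2) hBpos (by norm_num)
  simp only [Real.rpow_two, sq_abs] at h0
  have hG : Real.Gamma ((2 + 1) / 2) = 1 / 2 * Real.sqrt Real.pi := by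
    rw [show ((2 : ℝ) + 1) / 2 = 1 / 2 + 1 by norm_num, Real.Gamma_add_one (by norm_num),
      Real.Gamma_one_half_eq]
  have hp : (b + 1 / (2 * v)) ^ (-((2 : ℝ) + 1) / 2) =
      (b + 1 / (2 * v)) ^ (-(1 : ℝ) / 2) * (b + 1 / (2 * v))⁻¹ := by
    rw [← Real.rpow_neg_one, ← Real.rpow_add hBpos]; norm_num
  rw [h0, hG, hp, ← inv_sqrt_mul_rpow_mul_sqrt_pi hv hz hzb]
  have : (v : ℝ) / z ^ 2 = (b + 1 / (2 * v))⁻¹ / 2 := by rw [hB]; field_simp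
  rw [this]; ring

theorem integral_gaussianReal_pow_four_mul_exp_neg_sq {v : NNReal} (hv : v ≠ 0) {b z : ℝ} (hz : 0 < z)
    (hzb : z ^ 2 = 1 + 2 * b * v) :
    ∫ x, x ^ 4 * Real.exp (-b * x ^ 2) ∂(gaussianReal 0 v) = z⁻¹ * (3 * (v / z ^ 2) ^ 2) := by
  have hv' : (0 : ℝ) < v := by positivity
  have hB : b + 1 / (2 * v) = z ^ 2 / (2 * v) := by rw [hzb]; field_simp; ring
  have hBpos : 0 < b + 1 / (2 * v) := by rw [hB]; positivity
  rw [integral_gaussianReal_mul_exp hv b fun x => x ^ 4]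
  have h0 := integral_rpow_abs_mul_exp_neg_mul_sq (q := 4) hBpos (by norm_num)
  have h4 : ∀ x : ℝ, |x| ^ (4 : ℝ) = x ^ 4 := by
    intro x
    rw [show (4 : ℝ) = ((4 : ℕ) : ℝ) by norm_num, Real.rpow_natCast]
    exact (by decide : Even 4).pow_abs x
  simp only [h4] at h0
  have hG : Real.Gamma ((4 + 1) / 2) = 3 / 4 * Real.sqrt Real.pi := by
    rw [show ((4 : ℝ) + 1) / 2 = 1 / 2 + 1 + 1 by norm_num, Real.Gamma_add_one (by norm_num),
      Real.Gamma_add_one (by norm_num), Real.Gamma_one_half_eq]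
    ring
  have hp : (b + 1 / (2 * v)) ^ (-((4 : ℝ) + 1) / 2) =
      (b + 1 / (2 * v)) ^ (-(1 : ℝ) / 2) * ((b + 1 / (2 * v))⁻¹ * (b + 1 / (2 * v))⁻¹) := by
    rw [← Real.rpow_neg_one, ← Real.rpow_add hBpos, ← Real.rpow_add hBpos]; norm_num
  rw [h0, hG, hp, ← inv_sqrt_mul_rpow_mul_sqrt_pi hv hz hzb]
  have : (v : ℝ) / z ^ 2 = (b + 1 / (2 * v))⁻¹ / 2 := by rw [hB]; field_simp
  rw [this]; ring

theorem integrable_pow_mul_exp_neg_sq_gaussianReal {v : NNReal} {b : ℝ} (hb : 0 ≤ b) (k : ℕ) :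
    Integrable (fun x => x ^ k * Real.exp (-b * x ^ 2)) (gaussianReal 0 v) := by
  have h : Integrable (fun x : ℝ => x ^ k) (gaussianReal 0 v) := by
    have := integrable_pow_of_mem_interior_integrableExpSet (X := id) (μ := gaussianReal 0 v)
      (by rw [integrableExpSet_id_gaussianReal]; simp) k
    simpa using this
  refine h.mul_bdd (c := 1) (by fun_prop) (Filter.Eventually.of_forall fun x => ?_)
  rw [Real.norm_eq_abs, Real.abs_exp]
  exact Real.exp_le_one_iff.2 (by nlinarith [sq_nonneg x])

/-- Singular value decomposition of a real square matrix. -/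
theorem Matrix.exists_svd {n : ℕ} (G : Matrix (Fin n) (Fin n) ℝ) :
    ∃ (B V : Matrix (Fin n) (Fin n) ℝ) (d : Fin n → ℝ), Bᵀ * B = 1 ∧ Vᵀ * V = 1 ∧
      (∀ i, 0 ≤ d i) ∧ G = B * Matrix.diagonal d * Vᵀ := by
  have hpsd : (Gᵀ * G).PosSemidef := by
    simpa using Matrix.posSemidef_conjTranspose_mul_self G
  have hH := hpsd.isHermitian
  set V : Matrix (Fin n) (Fin n) ℝ := (hH.eigenvectorUnitary).1 with hVdef
  have hV : Vᵀ * V = 1 := by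
    have := (Matrix.mem_unitaryGroup_iff'.1 hH.eigenvectorUnitary.2)
    simpa [Matrix.star_eq_conjTranspose] using this
  have hV' : V * Vᵀ = 1 := mul_eq_one_comm.1 hV
  set l := hH.eigenvalues with hl
  have hl0 : ∀ i, 0 ≤ l i := hpsd.eigenvalues_nonneg
  have hspec : Gᵀ * G = V * Matrix.diagonal l * Vᵀ := by
    have := hH.spectral_theorem
    simpa [Matrix.star_eq_conjTranspose, Unitary.conjStarAlgAut_apply, Function.comp_def]
      using this
  set M := G * V with hM
  have hMM : Mᵀ * M = Matrix.diagonal l := by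
    rw [hM, transpose_mul, Matrix.mul_assoc, ← Matrix.mul_assoc Gᵀ, hspec]
    simp only [Matrix.mul_assoc, hV, Matrix.mul_one]
    rw [← Matrix.mul_assoc, hV, Matrix.one_mul]
  have hcol : ∀ i j, ∑ a, M a i * M a j = if i = j then l i else 0 := by
    intro i j
    have := congrFun (congrFun hMM i) j
    simpa [Matrix.mul_apply, Matrix.diagonal_apply] using this
  let w : Fin n → EuclideanSpace ℝ (Fin n) := fun i =>
    WithLp.toLp 2 fun a => (Real.sqrt (l i))⁻¹ * M a i
  have hw : Orthonormal ℝ ({i | l i ≠ 0}.domRestrict w) := by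
    rw [orthonormal_iff_ite]
    rintro ⟨i, hi⟩ ⟨j, hj⟩
    have hi' : 0 < l i := lt_of_le_of_ne (hl0 i) (Ne.symm hi)
    have : inner ℝ (w i) (w j) = (Real.sqrt (l i))⁻¹ * (Real.sqrt (l j))⁻¹ *
        ∑ a, M a i * M a j := by
      simp only [w, PiLp.inner_apply, Finset.mul_sum, RCLike.inner_apply, conj_trivial]
      exact Finset.sum_congr rfl fun a _ => by ring
    change inner ℝ (w i) (w j) = _
    simp only [Subtype.mk.injEq, this, hcol]
    split_ifs with h
    · subst h
      rw [← mul_inv, Real.mul_self_sqrt hi'.le, inv_mul_cancel₀ hi'.ne']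
    · simp
  obtain ⟨e, he⟩ := hw.exists_orthonormalBasis_extension_of_card_eq (by simp)
  refine ⟨Matrix.of fun a i => e i a, V, fun i => Real.sqrt (l i), ?_, hV,
    fun i => Real.sqrt_nonneg _, ?_⟩
  · ext i j
    have := orthonormal_iff_ite.1 e.orthonormal i j
    rw [Matrix.one_apply, ← this]
    simp only [Matrix.mul_apply, transpose_apply, Matrix.of_apply, PiLp.inner_apply,
      RCLike.inner_apply, conj_trivial]
    exact Finset.sum_congr rfl fun a _ => by ring
  · have : (Matrix.of fun a i => e i a) * Matrix.diagonal (fun i => Real.sqrt (l i)) = M := by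
      ext a i
      rw [Matrix.mul_diagonal, Matrix.of_apply]
      by_cases hi : l i = 0
      · have h0 := hcol i i
        rw [if_pos rfl, hi, Finset.sum_eq_zero_iff_of_nonneg
          (fun a _ => mul_self_nonneg _)] at h0
        have := mul_self_eq_zero.1 (h0 a (Finset.mem_univ a))
        rw [hi, this]; simp
      · have hi' : 0 < l i := lt_of_le_of_ne (hl0 i) (Ne.symm hi)
        have := Real.sqrt_pos.2 hi'
        rw [he i hi]
        simp only [w]
        field_simp
    rw [this, hM, Matrix.mul_assoc, hV', Matrix.mul_one]

theorem Matrix.exists_orthogonal_trace_ge {n : ℕ} (G : Matrix (Fin n) (Fin n) ℝ) :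
    ∃ O : Matrix (Fin n) (Fin n) ℝ, Oᵀ * O = 1 ∧ ∀ s : ℝ, 0 ≤ s →
      (3 * s * (Gᵀ * G).trace - s ^ 3 * (Gᵀ * G * (Gᵀ * G)).trace) / 2 ≤ (Oᵀ * G).trace := by
  obtain ⟨B, V, d, hB, hV, hd, rfl⟩ := G.exists_svd
  have conj_trace : ∀ D : Matrix (Fin n) (Fin n) ℝ, (V * D * Vᵀ).trace = D.trace := by
    intro D
    rw [Matrix.trace_mul_comm, ← Matrix.mul_assoc, hV, Matrix.one_mul]
  have conj_mul : ∀ D E : Matrix (Fin n) (Fin n) ℝ,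
      V * D * Vᵀ * (V * E * Vᵀ) = V * (D * E) * Vᵀ := by
    intro D E
    calc V * D * Vᵀ * (V * E * Vᵀ) = V * D * (Vᵀ * V) * E * Vᵀ := by simp only [Matrix.mul_assoc]
      _ = _ := by rw [hV]; simp only [Matrix.mul_assoc, Matrix.one_mul]
  have h1 : (B * Vᵀ)ᵀ * (B * Matrix.diagonal d * Vᵀ) = V * Matrix.diagonal d * Vᵀ := by
    calc _ = V * (Bᵀ * B) * Matrix.diagonal d * Vᵀ := by
          simp only [transpose_mul, transpose_transpose, Matrix.mul_assoc]
      _ = _ := by rw [hB, Matrix.mul_one]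
  have h2 : (B * Matrix.diagonal d * Vᵀ)ᵀ * (B * Matrix.diagonal d * Vᵀ) =
      V * (Matrix.diagonal d * Matrix.diagonal d) * Vᵀ := by
    calc _ = V * Matrix.diagonal d * (Bᵀ * B) * Matrix.diagonal d * Vᵀ := by
          simp only [transpose_mul, transpose_transpose, Matrix.mul_assoc, diagonal_transpose]
      _ = _ := by rw [hB]; simp only [Matrix.mul_one, Matrix.mul_assoc]
  refine ⟨B * Vᵀ, ?_, fun s hs => ?_⟩
  · calc _ = V * (Bᵀ * B) * Vᵀ := by
          simp only [transpose_mul, transpose_transpose, Matrix.mul_assoc]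
      _ = _ := by rw [hB, Matrix.mul_one]; exact mul_eq_one_comm.1 hV
  rw [h1, h2, conj_mul, conj_trace, conj_trace, conj_trace]
  simp only [Matrix.diagonal_mul_diagonal, Matrix.trace_diagonal, Finset.mul_sum]
  rw [← Finset.sum_sub_distrib, Finset.sum_div]
  refine Finset.sum_le_sum fun i _ => ?_
  have := mul_nonneg (mul_nonneg (hd i) (sq_nonneg (s * d i - 1)))
    (add_nonneg (mul_nonneg hs (hd i)) zero_le_two)
  nlinarith [this]

/-- The damping factor `exp (-b * ‖G‖²)` (Frobenius norm), as a product over the entries. -/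
noncomputable def gaussianDamping {n : ℕ} (b : ℝ) (G : Matrix (Fin n) (Fin n) ℝ) : ℝ :=
  ∏ i, ∏ k, Real.exp (-b * G i k ^ 2)

theorem gaussianDamping_pow_three {n : ℕ} (b : ℝ) (G : Matrix (Fin n) (Fin n) ℝ) :
    gaussianDamping b G ^ 3 = gaussianDamping (3 * b) G := by
  simp only [gaussianDamping, ← Finset.prod_pow, ← Real.exp_nat_mul]
  refine Finset.prod_congr rfl fun i _ => Finset.prod_congr rfl fun k _ => ?_
  congr 1; push_cast; ring

theorem gaussianDamping_nonneg {n : ℕ} (b : ℝ) (G : Matrix (Fin n) (Fin n) ℝ) :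
    0 ≤ gaussianDamping b G :=
  Finset.prod_nonneg fun _ _ => Finset.prod_nonneg fun _ _ => (Real.exp_pos _).le

theorem prod_pow_mul_gaussianDamping {n : ℕ} (b : ℝ) (m : Fin n → Fin n → ℕ)
    (G : Matrix (Fin n) (Fin n) ℝ) :
    (∏ i, ∏ k, G i k ^ m i k) * gaussianDamping b G =
      ∏ i, ∏ k, (fun x => x ^ m i k * Real.exp (-b * x ^ 2)) (G i k) := by
  simp only [gaussianDamping, ← Finset.prod_mul_distrib]

theorem prod_pow_ite_and {n : ℕ} (G : Matrix (Fin n) (Fin n) ℝ) (a c : Fin n) :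
    ∏ i, ∏ k, G i k ^ (if i = a ∧ k = c then 1 else 0) = G a c := by
  rw [Finset.prod_eq_single a, Finset.prod_eq_single c] <;> simp +contextual

theorem sq_mul_gaussianDamping {n : ℕ} (b : ℝ) (G : Matrix (Fin n) (Fin n) ℝ) (a c : Fin n) :
    G a c ^ 2 * gaussianDamping b G = ∏ i, ∏ k, (fun x : ℝ =>
      x ^ (if i = a ∧ k = c then 2 else 0) * Real.exp (-b * x ^ 2)) (G i k) := by
  rw [← prod_pow_mul_gaussianDamping, Finset.prod_eq_single a, Finset.prod_eq_single c] <;>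
    simp +contextual

theorem four_mul_gaussianDamping {n : ℕ} (b : ℝ) (G : Matrix (Fin n) (Fin n) ℝ)
    (i j k l : Fin n) :
    G i k * G i l * G j k * G j l * gaussianDamping b G = ∏ p, ∏ q, (fun x : ℝ => x ^
      ((if p = i ∧ q = k then 1 else 0) + (if p = i ∧ q = l then 1 else 0) +
        (if p = j ∧ q = k then 1 else 0) + (if p = j ∧ q = l then 1 else 0)) *
      Real.exp (-b * x ^ 2)) (G p q) := by
  rw [← prod_pow_mul_gaussianDamping]
  simp only [pow_add, Finset.prod_mul_distrib, prod_pow_ite_and]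

theorem integrable_entries_two {n : ℕ} {v : NNReal} {b : ℝ} (hb : 0 ≤ b) (i k : Fin n) :
    Integrable (fun G => G i k ^ 2 * gaussianDamping b G) (gaussianMatrix n v) := by
  simp only [sq_mul_gaussianDamping]
  exact integrable_gaussianMatrix_prod fun p q => integrable_pow_mul_exp_neg_sq_gaussianReal hb _

theorem integrable_entries_four {n : ℕ} {v : NNReal} {b : ℝ} (hb : 0 ≤ b) (i j k l : Fin n) :
    Integrable (fun G => G i k * G i l * G j k * G j l * gaussianDamping b G)
      (gaussianMatrix n v) := by
  simp only [four_mul_gaussianDamping]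
  exact integrable_gaussianMatrix_prod fun p q => integrable_pow_mul_exp_neg_sq_gaussianReal hb _

theorem prod_prod_inv_mul {n : ℕ} (z : ℝ) (M : Fin n → Fin n → ℝ) :
    ∏ i, ∏ k, z⁻¹ * M i k = z⁻¹ ^ (n * n) * ∏ i, ∏ k, M i k := by
  simp [Finset.prod_mul_distrib, pow_mul]

theorem prod_prod_ite_and {n : ℕ} (x : ℝ) (a c : Fin n) :
    ∏ i, ∏ k, (if i = a ∧ k = c then x else 1) = x := by
  rw [Finset.prod_eq_single a, Finset.prod_eq_single c] <;> simp +contextual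

theorem prod_prod_ite_and_mul {n : ℕ} (x : ℝ) (a c a' c' : Fin n) :
    ∏ i, ∏ k, ((if i = a ∧ k = c then x else 1) * (if i = a' ∧ k = c' then x else 1)) = x * x := by
  simp only [Finset.prod_mul_distrib, prod_prod_ite_and]

theorem integral_entries_two {n : ℕ} {v : NNReal} (hv : v ≠ 0) {b z : ℝ} (hz : 0 < z)
    (hzb : z ^ 2 = 1 + 2 * b * v) (i k : Fin n) :
    ∫ G, G i k ^ 2 * gaussianDamping b G ∂(gaussianMatrix n v) =
      z⁻¹ ^ (n * n) * (v / z ^ 2) := by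
  simp only [sq_mul_gaussianDamping]
  rw [integral_gaussianMatrix_prod (fun p q x =>
    x ^ (if p = i ∧ q = k then 2 else 0) * Real.exp (-b * x ^ 2)),
    ← prod_prod_ite_and ((v : ℝ) / z ^ 2) i k, ← prod_prod_inv_mul]
  refine Finset.prod_congr rfl fun p _ => Finset.prod_congr rfl fun q _ => ?_
  split_ifs
  · exact integral_gaussianReal_sq_mul_exp_neg_sq hv hz hzb
  · simpa using integral_gaussianReal_exp_neg_sq hv hz hzb

theorem integral_entries_four {n : ℕ} {v : NNReal} (hv : v ≠ 0) {b z : ℝ} (hz : 0 < z)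
    (hzb : z ^ 2 = 1 + 2 * b * v) (i j k l : Fin n) :
    ∫ G, G i k * G i l * G j k * G j l * gaussianDamping b G ∂(gaussianMatrix n v) =
      z⁻¹ ^ (n * n) * (v / z ^ 2) ^ 2 *
        ((if i = j then 1 else 0) + (if k = l then 1 else 0) +
          (if i = j then 1 else 0) * (if k = l then 1 else 0)) := by
  have m0 := integral_gaussianReal_exp_neg_sq hv hz hzb
  have m1 := integral_gaussianReal_id_mul_exp_neg_sq (b := b) hv
  have m2 := integral_gaussianReal_sq_mul_exp_neg_sq hv hz hzb
  have m4 := integral_gaussianReal_pow_four_mul_exp_neg_sq hv hz hzb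
  simp only [four_mul_gaussianDamping]
  rw [integral_gaussianMatrix_prod (fun p q x => x ^
      ((if p = i ∧ q = k then 1 else 0) + (if p = i ∧ q = l then 1 else 0) +
        (if p = j ∧ q = k then 1 else 0) + (if p = j ∧ q = l then 1 else 0)) *
      Real.exp (-b * x ^ 2))]
  by_cases hij : i = j
  · subst hij
    by_cases hkl : k = l
    · subst hkl
      rw [mul_assoc]
      trans z⁻¹ ^ (n * n) * (3 * ((v : ℝ) / z ^ 2) ^ 2)
      · rw [← prod_prod_ite_and (3 * ((v : ℝ) / z ^ 2) ^ 2) i k, ← prod_prod_inv_mul]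
        refine Finset.prod_congr rfl fun p _ => Finset.prod_congr rfl fun q _ => ?_
        split_ifs
        · simpa using m4
        · simpa using m0
      · simp only [if_true]; ring
    · rw [mul_assoc]
      trans z⁻¹ ^ (n * n) * (((v : ℝ) / z ^ 2) * ((v : ℝ) / z ^ 2))
      · rw [← prod_prod_ite_and_mul _ i k i l, ← prod_prod_inv_mul]
        refine Finset.prod_congr rfl fun p _ => Finset.prod_congr rfl fun q _ => ?_
        by_cases h1 : p = i ∧ q = k
        · have h2 : ¬ (p = i ∧ q = l) := fun h => hkl (h1.2.symm.trans h.2)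
          simpa [h1, h2, hkl] using m2
        · by_cases h2 : p = i ∧ q = l
          · simpa [h1, h2, hkl, Ne.symm hkl] using m2
          · simpa [h1, h2] using m0
      · simp only [hkl, if_true, if_false]; ring
  · by_cases hkl : k = l
    · subst hkl
      rw [mul_assoc]
      trans z⁻¹ ^ (n * n) * (((v : ℝ) / z ^ 2) * ((v : ℝ) / z ^ 2))
      · rw [← prod_prod_ite_and_mul _ i k j k, ← prod_prod_inv_mul]
        refine Finset.prod_congr rfl fun p _ => Finset.prod_congr rfl fun q _ => ?_
        by_cases h1 : p = i ∧ q = k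
        · simpa [h1, hij] using m2
        · by_cases h2 : p = j ∧ q = k
          · simpa [h1, h2, hij, Ne.symm hij] using m2
          · simpa [h1, h2] using m0
      · simp only [hij, if_true, if_false]; ring
    · simp only [hij, hkl, if_false]
      rw [Finset.prod_eq_zero (Finset.mem_univ i)]
      · ring
      · refine Finset.prod_eq_zero (Finset.mem_univ k) ?_
        simpa [hij, hkl] using m1

theorem trace_transpose_mul_self_eq {n : ℕ} (G : Matrix (Fin n) (Fin n) ℝ) :
    (Gᵀ * G).trace = ∑ k, ∑ i, G i k ^ 2 := by
  simp [Matrix.trace, Matrix.mul_apply, pow_two]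

theorem trace_transpose_mul_self_sq_eq {n : ℕ} (G : Matrix (Fin n) (Fin n) ℝ) :
    (Gᵀ * G * (Gᵀ * G)).trace = ∑ k, ∑ l, ∑ i, ∑ j, G i k * G i l * G j k * G j l := by
  simp only [Matrix.trace, Matrix.mul_apply, Matrix.diag, transpose_apply, Finset.sum_mul_sum]
  refine Finset.sum_congr rfl fun k _ => Finset.sum_congr rfl fun l _ =>
    Finset.sum_congr rfl fun i _ => Finset.sum_congr rfl fun j _ => by ring

theorem integrable_trace_mul_gaussianDamping {n : ℕ} {v : NNReal} {b : ℝ} (hb : 0 ≤ b) :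
    Integrable (fun G => (Gᵀ * G).trace * gaussianDamping b G) (gaussianMatrix n v) := by
  simp only [trace_transpose_mul_self_eq, Finset.sum_mul]
  exact integrable_finsetSum _ fun k _ => integrable_finsetSum _ fun i _ =>
    integrable_entries_two hb i k

theorem integrable_trace_sq_mul_gaussianDamping {n : ℕ} {v : NNReal} {b : ℝ} (hb : 0 ≤ b) :
    Integrable (fun G => (Gᵀ * G * (Gᵀ * G)).trace * gaussianDamping b G)
      (gaussianMatrix n v) := by
  simp only [trace_transpose_mul_self_sq_eq, Finset.sum_mul]
  exact integrable_finsetSum _ fun k _ => integrable_finsetSum _ fun l _ =>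
    integrable_finsetSum _ fun i _ => integrable_finsetSum _ fun j _ =>
    integrable_entries_four hb i j k l

theorem integral_trace_mul_gaussianDamping {n : ℕ} {v : NNReal} (hv : v ≠ 0) {b z : ℝ}
    (hb : 0 ≤ b) (hz : 0 < z) (hzb : z ^ 2 = 1 + 2 * b * v) :
    ∫ G, (Gᵀ * G).trace * gaussianDamping b G ∂(gaussianMatrix n v) =
      n ^ 2 * (z⁻¹ ^ (n * n) * (v / z ^ 2)) := by
  simp only [trace_transpose_mul_self_eq, Finset.sum_mul]
  rw [integral_finsetSum _ fun k _ => integrable_finsetSum _ fun i _ =>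
    integrable_entries_two hb i k]
  simp_rw [integral_finsetSum _ fun i _ => integrable_entries_two hb i _,
    integral_entries_two hv hz hzb]
  simp; ring

theorem integral_trace_sq_mul_gaussianDamping {n : ℕ} {v : NNReal} (hv : v ≠ 0) {b z : ℝ}
    (hb : 0 ≤ b) (hz : 0 < z) (hzb : z ^ 2 = 1 + 2 * b * v) :
    ∫ G, (Gᵀ * G * (Gᵀ * G)).trace * gaussianDamping b G ∂(gaussianMatrix n v) =
      (2 * n ^ 3 + n ^ 2) * (z⁻¹ ^ (n * n) * (v / z ^ 2) ^ 2) := by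
  simp only [trace_transpose_mul_self_sq_eq, Finset.sum_mul]
  rw [integral_finsetSum _ fun k _ => integrable_finsetSum _ fun l _ =>
    integrable_finsetSum _ fun i _ => integrable_finsetSum _ fun j _ =>
    integrable_entries_four hb i j k l]
  simp_rw [integral_finsetSum _ fun l _ => integrable_finsetSum _ fun i _ =>
    integrable_finsetSum _ fun j _ => integrable_entries_four hb i j _ l,
    integral_finsetSum _ fun i _ => integrable_finsetSum _ fun j _ =>
      integrable_entries_four hb i j _ _,
    integral_finsetSum _ fun j _ => integrable_entries_four hb _ j _ _,
    integral_entries_four hv hz hzb, ← Finset.mul_sum]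
  simp only [Finset.sum_add_distrib, ← Finset.mul_sum, ← Finset.sum_mul]
  simp
  ring

/-- A polynomial lower bound for `max_O tr (Oᵀ G)`, damped so as to have large Gaussian mean. -/
noncomputable def dampedTrace {n : ℕ} (β γ : ℝ) (G : Matrix (Fin n) (Fin n) ℝ) : ℝ :=
  (3 * (β * gaussianDamping γ G) * (Gᵀ * G).trace -
    (β * gaussianDamping γ G) ^ 3 * (Gᵀ * G * (Gᵀ * G)).trace) / 2

theorem dampedTrace_eq {n : ℕ} (β γ : ℝ) (G : Matrix (Fin n) (Fin n) ℝ) :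
    dampedTrace β γ G = 3 * β / 2 * ((Gᵀ * G).trace * gaussianDamping γ G) -
      β ^ 3 / 2 * ((Gᵀ * G * (Gᵀ * G)).trace * gaussianDamping (3 * γ) G) := by
  rw [← gaussianDamping_pow_three, dampedTrace]; ring

theorem measurable_dampedTrace {n : ℕ} (β γ : ℝ) :
    Measurable (dampedTrace β γ : Matrix (Fin n) (Fin n) ℝ → ℝ) := by
  have he : ∀ i j : Fin n, Measurable fun G : Matrix (Fin n) (Fin n) ℝ => G i j := fun i j =>
    measurable_id.matrix_entry i j
  unfold dampedTrace gaussianDamping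
  simp only [trace_transpose_mul_self_eq, trace_transpose_mul_self_sq_eq]
  fun_prop

theorem integrable_dampedTrace {n : ℕ} {v : NNReal} (β : ℝ) {γ : ℝ} (hγ : 0 ≤ γ) :
    Integrable (dampedTrace β γ) (gaussianMatrix n v) := by
  simp only [funext (dampedTrace_eq (n := n) β γ)]
  exact ((integrable_trace_mul_gaussianDamping hγ).const_mul _).sub
    ((integrable_trace_sq_mul_gaussianDamping (by positivity)).const_mul _)

theorem integral_dampedTrace {n : ℕ} {v : NNReal} (hv : v ≠ 0) (β : ℝ) {γ a c : ℝ} (hγ : 0 ≤ γ)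
    (ha : 0 < a) (hc : 0 < c) (haγ : a ^ 2 = 1 + 2 * γ * v) (hcγ : c ^ 2 = 1 + 2 * (3 * γ) * v) :
    ∫ G, dampedTrace β γ G ∂(gaussianMatrix n v) =
      3 * β / 2 * (n ^ 2 * (a⁻¹ ^ (n * n) * (v / a ^ 2))) -
        β ^ 3 / 2 * ((2 * n ^ 3 + n ^ 2) * (c⁻¹ ^ (n * n) * (v / c ^ 2) ^ 2)) := by
  simp only [dampedTrace_eq]
  rw [integral_sub ((integrable_trace_mul_gaussianDamping hγ).const_mul _)
    ((integrable_trace_sq_mul_gaussianDamping (by positivity)).const_mul _),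
    integral_const_mul, integral_const_mul, integral_trace_mul_gaussianDamping hv hγ ha haγ,
    integral_trace_sq_mul_gaussianDamping hv (by positivity) hc hcγ]

theorem exists_integral_dampedTrace_gt {n : ℕ} (hn : 0 < n) :
    ∃ β γ : ℝ, 0 ≤ β ∧ 0 ≤ γ ∧
      2 / 3 * (n : ℝ) < ∫ G, dampedTrace β γ G ∂(gaussianMatrix n (n : NNReal)⁻¹) := by
  have hn' : (0 : ℝ) < n := by exact_mod_cast hn
  have hv : (n : NNReal)⁻¹ ≠ 0 := by positivity
  have key : ∀ β a c : ℝ, 0 ≤ β → 1 ≤ a → 0 < c → c ^ 2 = 3 * a ^ 2 - 2 →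
      2 / 3 * (n : ℝ) < 3 * β / 2 * (n ^ 2 * (a⁻¹ ^ (n * n) * ((n : ℝ)⁻¹ / a ^ 2))) -
        β ^ 3 / 2 * ((2 * n ^ 3 + n ^ 2) * (c⁻¹ ^ (n * n) * ((n : ℝ)⁻¹ / c ^ 2) ^ 2)) →
      ∃ β γ : ℝ, 0 ≤ β ∧ 0 ≤ γ ∧
        2 / 3 * (n : ℝ) < ∫ G, dampedTrace β γ G ∂(gaussianMatrix n (n : NNReal)⁻¹) := by
    intro β a c hβ ha hc hac h
    have hγ : 0 ≤ (a ^ 2 - 1) * n / 2 := by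
      have : 0 ≤ a ^ 2 - 1 := by nlinarith
      positivity
    refine ⟨β, (a ^ 2 - 1) * n / 2, hβ, hγ, ?_⟩
    rw [integral_dampedTrace hv β hγ (by linarith) hc (a := a) (c := c)]
    · simpa using h
    · push_cast; field_simp; ring
    · push_cast; field_simp; linarith
  rcases Nat.lt_or_ge n 5 with h5 | h5
  · interval_cases n
    · exact key (8/5) (17/13) (23/13) (by norm_num) (by norm_num) (by norm_num) (by norm_num)
        (by norm_num)
    · exact key (9/10) (353/337) (383/337) (by norm_num) (by norm_num) (by norm_num) (by norm_num)
        (by norm_num)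
    · exact key (7/6) (353/337) (383/337) (by norm_num) (by norm_num) (by norm_num) (by norm_num)
        (by norm_num)
    · exact key (11/7) (353/337) (383/337) (by norm_num) (by norm_num) (by norm_num) (by norm_num)
        (by norm_num)
  · refine key (2/3) 1 1 (by norm_num) le_rfl one_pos (by norm_num) ?_
    have h5' : (5 : ℝ) ≤ n := by exact_mod_cast h5
    have e : 3 * (2 / 3 : ℝ) / 2 * ((n : ℝ) ^ 2 * (1⁻¹ ^ (n * n) * ((n : ℝ)⁻¹ / 1 ^ 2))) -
        (2 / 3) ^ 3 / 2 * ((2 * (n : ℝ) ^ 3 + n ^ 2) *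
          (1⁻¹ ^ (n * n) * ((n : ℝ)⁻¹ / 1 ^ 2) ^ 2)) = n - 4 / 27 * (2 * n + 1) := by
      simp only [inv_one, one_pow]
      field_simp; ring
    rw [e]; linarith

theorem abs_entry_le_one_of_orthogonal {n : ℕ} {U : Matrix (Fin n) (Fin n) ℝ} (hU : Uᵀ * U = 1)
    (i k : Fin n) : |U i k| ≤ 1 := by
  have h := congrFun (congrFun hU k) k
  rw [Matrix.mul_apply, Matrix.one_apply_eq] at h
  have h' : U i k * U i k ≤ 1 := by
    rw [← h]
    exact Finset.single_le_sum (f := fun j => Uᵀ k j * U j k)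
      (fun j _ => mul_self_nonneg (U j k)) (Finset.mem_univ i)
  exact abs_le_one_iff_mul_self_le_one.2 h'

theorem integrable_entry_gaussianMatrix {n : ℕ} {v : NNReal} (i k : Fin n) :
    Integrable (fun G => G i k) (gaussianMatrix n v) := by
  have h := integrable_gaussianMatrix_prod (v := v) (f := fun p q (x : ℝ) =>
    x ^ (if p = i ∧ q = k then 1 else 0) * Real.exp (-0 * x ^ 2)) fun p q =>
      integrable_pow_mul_exp_neg_sq_gaussianReal le_rfl _
  simpa only [neg_zero, zero_mul, Real.exp_zero, mul_one, prod_pow_ite_and] using h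

theorem exists_measurable_orthogonal_of_lt {n : ℕ} {h : Matrix (Fin n) (Fin n) ℝ → ℝ}
    (hh : Measurable h)
    (hlt : ∀ G, ∃ O : Matrix (Fin n) (Fin n) ℝ, Oᵀ * O = 1 ∧ h G < (Oᵀ * G).trace) :
    ∃ F : Matrix (Fin n) (Fin n) ℝ → Matrix (Fin n) (Fin n) ℝ, Measurable F ∧
      (∀ G, (F G)ᵀ * F G = 1) ∧ ∀ G, h G < ((F G)ᵀ * G).trace := by
  classical
  let S := {O : Matrix (Fin n) (Fin n) ℝ // Oᵀ * O = 1}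
  have : SecondCountableTopology (Matrix (Fin n) (Fin n) ℝ) :=
    inferInstanceAs (SecondCountableTopology (Fin n → Fin n → ℝ))
  have : SecondCountableTopology S :=
    TopologicalSpace.Subtype.secondCountableTopology {O : Matrix (Fin n) (Fin n) ℝ | Oᵀ * O = 1}
  have : Nonempty S := ⟨⟨1, by simp⟩⟩
  let D : ℕ → S := TopologicalSpace.denseSeq S
  have hD : ∀ G, ∃ k, h G < ((D k).1ᵀ * G).trace := by
    intro G
    obtain ⟨O, hO, hG⟩ := hlt G
    have hcont : Continuous fun P : S => (P.1ᵀ * G).trace := by fun_prop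
    exact (TopologicalSpace.denseRange_denseSeq S).exists_mem_open
      (isOpen_lt continuous_const hcont) ⟨⟨O, hO⟩, hG⟩
  have hm : ∀ k, Measurable fun G : Matrix (Fin n) (Fin n) ℝ => ((D k).1ᵀ * G).trace := by
    intro k
    have : Measurable fun G : Matrix (Fin n) (Fin n) ℝ => (D k).1ᵀ * G := by fun_prop
    exact Finset.measurable_fun_sum _ fun i _ => this.matrix_entry i i
  have hfind : Measurable fun G => Nat.find (hD G) :=
    measurable_find hD fun k => measurableSet_lt hh (hm k)
  refine ⟨fun G => (D (Nat.find (hD G))).1, (measurable_of_countable fun k => (D k).1).comp hfind,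
    fun G => (D _).2, fun G => Nat.find_spec (hD G)⟩

theorem integrable_trace_transpose_mul {n : ℕ} {v : NNReal}
    {F : Matrix (Fin n) (Fin n) ℝ → Matrix (Fin n) (Fin n) ℝ} (hF : Measurable F)
    (hFo : ∀ G, (F G)ᵀ * F G = 1) (i k : Fin n) :
    Integrable (fun G => ((F G)ᵀ * G) i k) (gaussianMatrix n v) := by
  simp only [Matrix.mul_apply, transpose_apply]
  refine integrable_finsetSum _ fun j _ => ?_
  exact (integrable_entry_gaussianMatrix j k).bdd_mul (c := 1)
    (hF.matrix_entry j i).aestronglyMeasurable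
    (Filter.Eventually.of_forall fun G => abs_entry_le_one_of_orthogonal (hFo G) j i)

/-- A measurable selection of orthogonal matrices whose overlap with a normalized Gaussian matrix
has mean at least `2 / 3 * n`. -/
theorem exists_orthogonal_overlap {n : ℕ} (hn : 0 < n) :
    ∃ F : Matrix (Fin n) (Fin n) ℝ → Matrix (Fin n) (Fin n) ℝ, Measurable F ∧
      (∀ G, (F G)ᵀ * F G = 1) ∧
      2 / 3 * (n : ℝ) ≤ ∫ G, ((F G)ᵀ * G).trace ∂(gaussianMatrix n (n : NNReal)⁻¹) := by
  obtain ⟨β, γ, hβ, hγ, h⟩ := exists_integral_dampedTrace_gt hn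
  set I := ∫ G, dampedTrace β γ G ∂(gaussianMatrix n (n : NNReal)⁻¹) with hI
  obtain ⟨F, hF, hFo, hlt⟩ := exists_measurable_orthogonal_of_lt
    ((measurable_dampedTrace (n := n) β γ).sub_const (I - 2 / 3 * n)) fun G => by
      obtain ⟨O, hO, hs⟩ := G.exists_orthogonal_trace_ge
      have := hs _ (mul_nonneg hβ (gaussianDamping_nonneg γ G))
      exact ⟨O, hO, by unfold dampedTrace; linarith⟩
  refine ⟨F, hF, hFo, ?_⟩
  have hint := integrable_dampedTrace (n := n) (v := (n : NNReal)⁻¹) β hγ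
  calc 2 / 3 * (n : ℝ) = ∫ G, (dampedTrace β γ G - (I - 2 / 3 * n))
        ∂(gaussianMatrix n (n : NNReal)⁻¹) := by
        rw [integral_sub hint (integrable_const _)]; simp [← hI]
    _ ≤ _ := integral_mono (hint.sub (integrable_const _))
        (integrable_finsetSum _ fun i _ => integrable_trace_transpose_mul hF hFo i i)
        fun G => (hlt G).le

theorem map_mul_right_of_left_invariant {n : ℕ} {μ : Measure (Matrix (Fin n) (Fin n) ℝ)}
    [IsProbabilityMeasure μ] (h_orth : ∀ᵐ Q ∂μ, Qᵀ * Q = 1)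
    (h_inv : ∀ U : Matrix (Fin n) (Fin n) ℝ, Uᵀ * U = 1 → μ.map (fun Q => U * Q) = μ)
    {U : Matrix (Fin n) (Fin n) ℝ} (hU : Uᵀ * U = 1) : μ.map (fun Q => Q * U) = μ := by
  refine Measure.ext_of_lintegral _ fun f hf => ?_
  rw [lintegral_map hf (by fun_prop)]
  exact lintegral_mul_right_of_left_invariant h_orth h_inv hf hU

theorem transpose_mul_mul_apply {n : ℕ} (Q C : Matrix (Fin n) (Fin n) ℝ) (i k : Fin n) :
    (Qᵀ * C * Q) i k = ∑ b, ∑ a, (Q a i * Q b k) * C a b := by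
  simp only [Matrix.mul_apply, Finset.sum_mul, transpose_apply]
  exact Finset.sum_congr rfl fun b _ => Finset.sum_congr rfl fun a _ => by ring

theorem integrable_entry_mul_entry {n : ℕ} {μ : Measure (Matrix (Fin n) (Fin n) ℝ)}
    [IsProbabilityMeasure μ] (h_orth : ∀ᵐ Q ∂μ, Qᵀ * Q = 1) (a b i k : Fin n) :
    Integrable (fun Q => Q a i * Q b k) μ := by
  refine Integrable.of_bound (C := 1) ?_ ?_
  · exact ((measurable_id.matrix_entry a i).mul (measurable_id.matrix_entry b k)).aestronglyMeasurable
  · filter_upwards [h_orth] with Q hQ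
    rw [norm_mul]
    exact mul_le_one₀ (abs_entry_le_one_of_orthogonal hQ a i) (abs_nonneg _)
      (abs_entry_le_one_of_orthogonal hQ b k)

/-- Averaging the conjugates `Qᵀ C Q` over the orthogonal group gives a multiple of the identity. -/
theorem integral_conj_of_left_invariant {n : ℕ} {μ : Measure (Matrix (Fin n) (Fin n) ℝ)}
    [IsProbabilityMeasure μ] (h_orth : ∀ᵐ Q ∂μ, Qᵀ * Q = 1)
    (h_inv : ∀ U : Matrix (Fin n) (Fin n) ℝ, Uᵀ * U = 1 → μ.map (fun Q => U * Q) = μ)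
    (C : Matrix (Fin n) (Fin n) ℝ) (i k : Fin n) :
    ∫ Q, (Qᵀ * C * Q) i k ∂μ = C.trace / n * (1 : Matrix (Fin n) (Fin n) ℝ) i k := by
  set S : Fin n → Fin n → ℝ := fun i k => ∫ Q, (Qᵀ * C * Q) i k ∂μ with hS
  have hmeas : ∀ i k, Measurable fun Q : Matrix (Fin n) (Fin n) ℝ => (Qᵀ * C * Q) i k :=
    fun i k => Measurable.matrix_entry (f := fun Q => Qᵀ * C * Q) (by fun_prop) i k
  have hconj : ∀ U : Matrix (Fin n) (Fin n) ℝ, Uᵀ * U = 1 → ∀ i k,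
      S i k = ∫ Q, ((Q * U)ᵀ * C * (Q * U)) i k ∂μ := by
    intro U hU i k
    simp only [hS]
    conv_lhs => rw [← map_mul_right_of_left_invariant h_orth h_inv hU]
    exact integral_map (Measurable.aemeasurable (by fun_prop)) (hmeas i k).aestronglyMeasurable
  have hoff : ∀ i k, i ≠ k → S i k = 0 := by
    intro i k hik
    have h := hconj (Matrix.diagonal fun a => if a = i then -1 else 1) (by
      ext a b
      by_cases hab : a = b
      · subst hab
        by_cases hai : a = i <;> simp [hai]
      · simp [hab]) i k
    have e : ∀ Q : Matrix (Fin n) (Fin n) ℝ,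
        ((Q * Matrix.diagonal fun a => if a = i then (-1 : ℝ) else 1)ᵀ * C *
          (Q * Matrix.diagonal fun a => if a = i then (-1 : ℝ) else 1)) i k =
            -(Qᵀ * C * Q) i k := by
      intro Q
      rw [transpose_mul, diagonal_transpose, ← Matrix.mul_assoc, Matrix.mul_diagonal,
        Matrix.mul_assoc, Matrix.mul_assoc, Matrix.diagonal_mul, if_pos rfl, if_neg (Ne.symm hik),
        ← Matrix.mul_assoc]
      ring
    simp only [e, integral_neg] at h
    simp only [hS] at h ⊢
    linarith
  have hdiag : ∀ i k, S i i = S k k := by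
    intro i k
    have h := hconj ((1 : Matrix (Fin n) (Fin n) ℝ).submatrix id (Equiv.swap i k)) (by
      ext a b
      simp [Matrix.mul_apply, Matrix.one_apply]) i i
    have e : ∀ Q : Matrix (Fin n) (Fin n) ℝ,
        Q * (1 : Matrix (Fin n) (Fin n) ℝ).submatrix id (Equiv.swap i k) =
          Q.submatrix id (Equiv.swap i k) := by
      intro Q
      ext a b
      simp [Matrix.mul_apply, Matrix.one_apply]
    simp only [e] at h
    rw [h]
    simp [hS, Matrix.mul_apply]
  have hint : ∀ i k, Integrable (fun Q : Matrix (Fin n) (Fin n) ℝ => (Qᵀ * C * Q) i k) μ := by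
    intro i k
    simp only [transpose_mul_mul_apply]
    exact integrable_finsetSum _ fun b _ => integrable_finsetSum _ fun a _ =>
      (integrable_entry_mul_entry h_orth a b i k).mul_const (C a b)
  have htrace : ∑ i, S i i = C.trace := by
    simp only [hS]
    rw [← integral_finsetSum _ fun i _ => hint i i]
    have : ∀ᵐ Q ∂μ, ∑ i, (Qᵀ * C * Q) i i = C.trace := by
      filter_upwards [h_orth] with Q hQ
      change (Qᵀ * C * Q).trace = _
      rw [Matrix.trace_mul_comm, ← Matrix.mul_assoc, mul_eq_one_comm.1 hQ, Matrix.one_mul]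
    rw [integral_congr_ae this]; simp
  change S i k = _
  by_cases hik : i = k
  · subst hik
    have hn : (n : ℝ) ≠ 0 := by exact_mod_cast (Fin.pos i).ne'
    rw [← htrace, Finset.sum_congr rfl fun k _ => hdiag k i]
    simp; field_simp
  · rw [hoff i k hik, Matrix.one_apply_ne hik, mul_zero]

/-- Writing a Gaussian matrix as `G = Q R` with `Q` Haar orthogonal and independent of `R`,
where the mean of `R` is a prescribed multiple of the identity. -/
theorem exists_factor_of_orthogonal_overlap {n : ℕ} {v : NNReal}
    {F : Matrix (Fin n) (Fin n) ℝ → Matrix (Fin n) (Fin n) ℝ} (hF : Measurable F)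
    (hFo : ∀ G, (F G)ᵀ * F G = 1)
    {μ : Measure (Matrix (Fin n) (Fin n) ℝ)} [IsProbabilityMeasure μ]
    (h_orth : ∀ᵐ Q ∂μ, Qᵀ * Q = 1)
    (h_inv : ∀ U : Matrix (Fin n) (Fin n) ℝ, Uᵀ * U = 1 → μ.map (fun Q => U * Q) = μ) :
    ∃ κ : Measure (Matrix (Fin n) (Fin n) ℝ), IsProbabilityMeasure κ ∧
      (μ.prod κ).map (fun p => p.1 * p.2) = gaussianMatrix n v ∧
      ∀ i k, Integrable (fun R => R i k) κ ∧ ∫ R, R i k ∂κ =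
        (∫ G, ((F G)ᵀ * G).trace ∂(gaussianMatrix n v)) / n *
          (1 : Matrix (Fin n) (Fin n) ℝ) i k := by
  set ν := gaussianMatrix n v with hν
  let T : Matrix (Fin n) (Fin n) ℝ × Matrix (Fin n) (Fin n) ℝ → Matrix (Fin n) (Fin n) ℝ :=
    fun p => p.1ᵀ * ((F p.2)ᵀ * p.2) * p.1
  have hT : Measurable T := by unfold T; fun_prop
  have hpos : ∀ᵐ p ∂(μ.prod ν), p.1ᵀ * p.1 = 1 := Measure.quasiMeasurePreserving_fst.ae h_orth
  refine ⟨(μ.prod ν).map T, Measure.isProbabilityMeasure_map hT.aemeasurable, ?_, fun i k => ?_⟩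
  · have : IsProbabilityMeasure ((μ.prod ν).map T) :=
      Measure.isProbabilityMeasure_map hT.aemeasurable
    refine Measure.ext_of_lintegral _ fun f hf => ?_
    have hl : ∀ g : Matrix (Fin n) (Fin n) ℝ → ENNReal, Measurable g →
        ∀ V : Matrix (Fin n) (Fin n) ℝ, Vᵀ * V = 1 → ∫⁻ G, g (V * G) ∂ν = ∫⁻ G, g G ∂ν := by
      intro g hg V hV
      conv_rhs => rw [hν, ← map_gaussianMatrix_mul_left hV, ← hν]
      rw [lintegral_map hg (by fun_prop)]
    have hr : ∀ g : Matrix (Fin n) (Fin n) ℝ → ENNReal, Measurable g →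
        ∀ V : Matrix (Fin n) (Fin n) ℝ, Vᵀ * V = 1 → ∫⁻ G, g (G * V) ∂ν = ∫⁻ G, g G ∂ν := by
      intro g hg V hV
      conv_rhs => rw [hν, ← map_gaussianMatrix_mul_right hV, ← hν]
      rw [lintegral_map hg (by fun_prop)]
    calc ∫⁻ M, f M ∂((μ.prod ((μ.prod ν).map T)).map fun p => p.1 * p.2)
        = ∫⁻ V, ∫⁻ p, f (V * T p) ∂(μ.prod ν) ∂μ := by
          rw [lintegral_map hf (by fun_prop), lintegral_prod _ (by fun_prop)]
          refine lintegral_congr fun V => ?_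
          rw [lintegral_map (by fun_prop) hT]
      _ = ∫⁻ p, ∫⁻ V, f (V * T p) ∂μ ∂(μ.prod ν) :=
          lintegral_lintegral_swap (Measurable.aemeasurable
            (by unfold Function.uncurry; fun_prop))
      _ = ∫⁻ p, ∫⁻ V, f (V * p.2 * p.1) ∂μ ∂(μ.prod ν) := by
          refine lintegral_congr_ae ?_
          filter_upwards [hpos] with p hp
          have hU : ((F p.2 * p.1)ᵀ)ᵀ * (F p.2 * p.1)ᵀ = 1 := by
            rw [transpose_transpose, mul_eq_one_comm, transpose_mul, Matrix.mul_assoc,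
              ← Matrix.mul_assoc (F p.2)ᵀ, hFo, Matrix.one_mul, hp]
          have := lintegral_mul_right_of_left_invariant h_orth h_inv
            (f := fun M => f (M * p.2 * p.1)) (by fun_prop) hU
          rw [← this]
          simp only [T, transpose_mul, Matrix.mul_assoc]
      _ = ∫⁻ W, ∫⁻ G, ∫⁻ V, f (V * G * W) ∂μ ∂ν ∂μ :=
          lintegral_prod _ (Measurable.aemeasurable
            (Measurable.lintegral_prod_right' (f := fun q : (Matrix (Fin n) (Fin n) ℝ ×
              Matrix (Fin n) (Fin n) ℝ) × Matrix (Fin n) (Fin n) ℝ => f (q.2 * q.1.2 * q.1.1))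
              (by fun_prop)))
      _ = ∫⁻ W, ∫⁻ V, ∫⁻ G, f (V * G * W) ∂ν ∂μ ∂μ := by
          refine lintegral_congr fun W => lintegral_lintegral_swap (Measurable.aemeasurable
            (by unfold Function.uncurry; fun_prop))
      _ = ∫⁻ W, ∫⁻ V, ∫⁻ G, f G ∂ν ∂μ ∂μ := by
          refine lintegral_congr_ae ?_
          filter_upwards [h_orth] with W hW
          refine lintegral_congr_ae ?_
          filter_upwards [h_orth] with V hV
          exact (hl (fun M => f (M * W)) (by fun_prop) V hV).trans (hr f hf W hW)
      _ = ∫⁻ G, f G ∂ν := by simp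
  · have hm : AEStronglyMeasurable (fun R : Matrix (Fin n) (Fin n) ℝ => R i k)
        ((μ.prod ν).map T) := (measurable_id.matrix_entry i k).aestronglyMeasurable
    have hterm : ∀ a b, Integrable (fun p : Matrix (Fin n) (Fin n) ℝ × Matrix (Fin n) (Fin n) ℝ =>
        (p.1 a i * p.1 b k) * ((F p.2)ᵀ * p.2) a b) (μ.prod ν) := fun a b =>
      (integrable_entry_mul_entry h_orth a b i k).mul_prod
        (integrable_trace_transpose_mul hF hFo a b)
    have hexp : ∀ p, T p i k = ∑ b, ∑ a, (p.1 a i * p.1 b k) * ((F p.2)ᵀ * p.2) a b := fun p =>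
      transpose_mul_mul_apply _ _ i k
    constructor
    · rw [integrable_map_measure hm hT.aemeasurable]
      change Integrable (fun p => T p i k) _
      simp only [hexp]
      exact integrable_finsetSum _ fun b _ => integrable_finsetSum _ fun a _ => hterm a b
    · rw [integral_map hT.aemeasurable hm]
      let C : Matrix (Fin n) (Fin n) ℝ := fun a b => ∫ G, ((F G)ᵀ * G) a b ∂ν
      have hC : ∫ G, ((F G)ᵀ * G).trace ∂ν = C.trace :=
        integral_finsetSum _ fun a _ => integrable_trace_transpose_mul hF hFo a a
      rw [hC, ← integral_conj_of_left_invariant h_orth h_inv C i k]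
      simp only [hexp]
      rw [integral_finsetSum _ fun b _ => integrable_finsetSum _ fun a _ => hterm a b]
      simp only [transpose_mul_mul_apply]
      rw [integral_finsetSum _ fun b _ => integrable_finsetSum _ fun a _ =>
        (integrable_entry_mul_entry h_orth a b i k).mul_const _]
      refine Finset.sum_congr rfl fun b _ => ?_
      rw [integral_finsetSum _ fun a _ => hterm a b, integral_finsetSum _ fun a _ =>
        (integrable_entry_mul_entry h_orth a b i k).mul_const _]
      refine Finset.sum_congr rfl fun a _ => ?_
      rw [integral_prod_mul (fun Q : Matrix (Fin n) (Fin n) ℝ => Q a i * Q b k)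
        (fun G => ((F G)ᵀ * G) a b), integral_mul_const]

theorem ConvexOn.map_integral_array_le {n : ℕ} {Ω : Type*} [MeasurableSpace Ω] {P : Measure Ω}
    [IsProbabilityMeasure P] {Ψ : (Fin n → Fin n → ℝ) → ℝ} (hΨ : ConvexOn ℝ Set.univ Ψ)
    {X : Ω → Fin n → Fin n → ℝ} (hX : ∀ i k, Integrable (fun ω => X ω i k) P)
    (hΨX : Integrable (fun ω => Ψ (X ω)) P) {m : Fin n → Fin n → ℝ}
    (hm : ∀ i k, ∫ ω, X ω i k ∂P = m i k) : Ψ m ≤ ∫ ω, Ψ (X ω) ∂P := by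
  have hX' : ∀ i, Integrable (fun ω => X ω i) P := fun i => Integrable.of_eval (hX i)
  have hmean : ∫ ω, X ω ∂P = m := by
    ext i k
    rw [eval_integral hX', eval_integral (hX i), hm]
  rw [← hmean]
  exact hΨ.map_integral_le hΨ.locallyLipschitz.continuous.continuousOn isClosed_univ
    (Filter.Eventually.of_forall fun _ => Set.mem_univ _) (Integrable.of_eval hX') hΨX

/-- Jensen's inequality for random matrices. -/
theorem ConvexOn.map_integral_matrix_le {n : ℕ} {Ω : Type*} [MeasurableSpace Ω] {P : Measure Ω}
    [IsProbabilityMeasure P] {Ψ : Matrix (Fin n) (Fin n) ℝ → ℝ} (hΨ : ConvexOn ℝ Set.univ Ψ)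
    {X : Ω → Matrix (Fin n) (Fin n) ℝ} (hX : ∀ i k, Integrable (fun ω => X ω i k) P)
    (hΨX : Integrable (fun ω => Ψ (X ω)) P) {m : Matrix (Fin n) (Fin n) ℝ}
    (hm : ∀ i k, ∫ ω, X ω i k ∂P = m i k) : Ψ m ≤ ∫ ω, Ψ (X ω) ∂P :=
  ConvexOn.map_integral_array_le (n := n) hΨ hX hΨX hm

theorem ConvexOn.continuous_array {n : ℕ} {Ψ : (Fin n → Fin n → ℝ) → ℝ}
    (hΨ : ConvexOn ℝ Set.univ Ψ) : Continuous Ψ :=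
  hΨ.locallyLipschitz.continuous

theorem ConvexOn.continuous_matrix {n : ℕ} {Ψ : Matrix (Fin n) (Fin n) ℝ → ℝ}
    (hΨ : ConvexOn ℝ Set.univ Ψ) : Continuous Ψ :=
  ConvexOn.continuous_array (n := n) hΨ

theorem exists_bound_of_continuous_array {n J : ℕ} {f : (Fin J → Fin n → Fin n → ℝ) → ℝ}
    (hf : Continuous f) : ∃ C, ∀ Q, (∀ j i k, |Q j i k| ≤ 1) → ‖f Q‖ ≤ C := by
  obtain ⟨C, hC⟩ := (isCompact_closedBall (0 : Fin J → Fin n → Fin n → ℝ) 1).exists_bound_of_continuousOn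
    hf.continuousOn
  refine ⟨C, fun Q hQ => hC Q ?_⟩
  rw [mem_closedBall_zero_iff]
  simpa only [pi_norm_le_iff_of_nonneg zero_le_one, Real.norm_eq_abs] using hQ

theorem integrable_of_continuous_of_orthogonal {n J : ℕ}
    {μ : Fin J → Measure (Matrix (Fin n) (Fin n) ℝ)} [∀ j, IsProbabilityMeasure (μ j)]
    (h_orth : ∀ j, ∀ᵐ Q ∂(μ j), Qᵀ * Q = 1)
    {f : (Fin J → Matrix (Fin n) (Fin n) ℝ) → ℝ} (hf : Continuous f) :
    Integrable f (Measure.pi μ) := by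
  have hae : ∀ᵐ Q ∂(Measure.pi μ), ∀ j, (Q j)ᵀ * Q j = 1 :=
    ae_all_iff.2 fun j => (Measure.quasiMeasurePreserving_eval μ j).ae (h_orth j)
  obtain ⟨C, hC⟩ := exists_bound_of_continuous_array (n := n) (J := J) hf
  have hmeas : Measurable f :=
    Continuous.measurable (α := Fin J → Fin n → Fin n → ℝ) hf
  refine Integrable.of_bound (C := C) ?_ ?_
  · exact hmeas.aestronglyMeasurable
  · filter_upwards [hae] with Q hQ
    exact hC Q fun j i k => abs_entry_le_one_of_orthogonal (hQ j) i k

/-- **Noncommutative Gaussian comparison principle.**  Fix matrices `A 1, …, A J`.  Let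
`μ j` be the Haar probability measure on the orthogonal group `O(n)` (characterized as a
probability measure supported on orthogonal matrices that is invariant under left
multiplication by orthogonal matrices), and let `ν` be the law of an `n × n` matrix with
independent `N(0, 1/n)` entries.  Modeling the independent families by the product measures
`Measure.pi μ` and `Measure.pi (fun _ => ν)`, for every nonnegative positively homogeneous
convex function `N` and every weakly increasing convex `Φ`,
`E Φ(N(Σ Q j * A j)) ≤ E Φ(1.5 · N(Σ G j * A j))`. -/
theorem noncommutative_gaussian_comparison
    (n J : ℕ) (hn : 0 < n)
    (A : Fin J → Matrix (Fin n) (Fin n) ℝ)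
    (μ : Fin J → Measure (Matrix (Fin n) (Fin n) ℝ)) [∀ j, IsProbabilityMeasure (μ j)]
    (hμ_orth : ∀ j, ∀ᵐ Q ∂(μ j), Qᵀ * Q = 1)
    (hμ_inv : ∀ j, ∀ U : Matrix (Fin n) (Fin n) ℝ, Uᵀ * U = 1 →
      (μ j).map (fun Q => U * Q) = μ j)
    (ν : Measure (Matrix (Fin n) (Fin n) ℝ))
    (hν : ν = Measure.pi fun _ : Fin n => Measure.pi fun _ : Fin n =>
      gaussianReal 0 ((n : NNReal))⁻¹)
    (N : Matrix (Fin n) (Fin n) ℝ → ℝ)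
    (hN_nonneg : ∀ M, 0 ≤ N M)
    (hN_hom : ∀ (c : ℝ) (M : Matrix (Fin n) (Fin n) ℝ), 0 ≤ c → N (c • M) = c * N M)
    (hN_convex : ConvexOn ℝ Set.univ N)
    (Φ : ℝ → ℝ) (hΦ_mono : Monotone Φ) (hΦ_convex : ConvexOn ℝ Set.univ Φ)
    (hint : Integrable (fun G : Fin J → Matrix (Fin n) (Fin n) ℝ =>
      Φ (1.5 * N (∑ j, G j * A j))) (Measure.pi fun _ : Fin J => ν)) :
    ∫ Q : Fin J → Matrix (Fin n) (Fin n) ℝ,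
        Φ (N (∑ j, Q j * A j)) ∂(Measure.pi μ)
      ≤ ∫ G : Fin J → Matrix (Fin n) (Fin n) ℝ,
          Φ (1.5 * N (∑ j, G j * A j)) ∂(Measure.pi fun _ : Fin J => ν) := by
  subst hν
  change Integrable _ (Measure.pi fun _ : Fin J => gaussianMatrix n (n : NNReal)⁻¹) at hint
  change _ ≤ ∫ G : Fin J → Matrix (Fin n) (Fin n) ℝ, Φ (1.5 * N (∑ j, G j * A j))
    ∂(Measure.pi fun _ : Fin J => gaussianMatrix n (n : NNReal)⁻¹)
  obtain ⟨F, hF, hFo, hoverlap⟩ := exists_orthogonal_overlap hn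
  set c : ℝ := (∫ G, ((F G)ᵀ * G).trace ∂(gaussianMatrix n (n : NNReal)⁻¹)) / n with hc
  have hc23 : 2 / 3 ≤ c := by
    rw [hc, le_div_iff₀ (by exact_mod_cast hn)]; exact hoverlap
  choose κ hκ hfactor hmean using fun j =>
    exists_factor_of_orthogonal_overlap (v := (n : NNReal)⁻¹) hF hFo (hμ_orth j) (hμ_inv j)
  set Ψ : Matrix (Fin n) (Fin n) ℝ → ℝ := fun M => Φ (1.5 * N M) with hΨdef
  have hΨ : ConvexOn ℝ Set.univ Ψ := by
    have h : ConvexOn ℝ Set.univ fun M => (1.5 : ℝ) * N M := hN_convex.smul (by norm_num)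
    refine ⟨convex_univ, fun x _ y _ a b ha hb hab => ?_⟩
    exact (hΦ_mono (h.2 (Set.mem_univ x) (Set.mem_univ y) ha hb hab)).trans
      (hΦ_convex.2 (Set.mem_univ _) (Set.mem_univ _) ha hb hab)
  have hLint : Integrable (fun Q : Fin J → Matrix (Fin n) (Fin n) ℝ => Φ (N (∑ j, Q j * A j)))
      (Measure.pi μ) := by
    refine integrable_of_continuous_of_orthogonal hμ_orth ?_
    have h1 : Continuous N := hN_convex.continuous_matrix
    have h2 : Continuous Φ := hΦ_convex.locallyLipschitz.continuous
    fun_prop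
  have hT : MeasurePreserving (fun p : (Fin J → Matrix (Fin n) (Fin n) ℝ) ×
      (Fin J → Matrix (Fin n) (Fin n) ℝ) => fun j => p.1 j * p.2 j)
      ((Measure.pi μ).prod (Measure.pi κ))
      (Measure.pi fun _ : Fin J => gaussianMatrix n (n : NNReal)⁻¹) :=
    (measurePreserving_pi (fun j => (μ j).prod (κ j)) _
      (fun j => ⟨by fun_prop, hfactor j⟩)).comp
      (measurePreserving_arrowProdEquivProdArrow _ _ _ μ κ).symm
  have hint' : Integrable (fun p : (Fin J → Matrix (Fin n) (Fin n) ℝ) ×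
      (Fin J → Matrix (Fin n) (Fin n) ℝ) => Ψ (∑ j, p.1 j * p.2 j * A j))
      ((Measure.pi μ).prod (Measure.pi κ)) := hT.integrable_comp_of_integrable hint
  have hRHS : ∫ G : Fin J → Matrix (Fin n) (Fin n) ℝ, Φ (1.5 * N (∑ j, G j * A j))
        ∂(Measure.pi fun _ : Fin J => gaussianMatrix n (n : NNReal)⁻¹) =
      ∫ Q, ∫ R, Ψ (∑ j, Q j * R j * A j) ∂(Measure.pi κ) ∂(Measure.pi μ) := by
    rw [← integral_prod _ hint', ← hT.map_eq, integral_map hT.aemeasurable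
      (hT.map_eq ▸ hint.aestronglyMeasurable)]
  rw [hRHS]
  refine integral_mono_ae hLint hint'.integral_prod_left ?_
  filter_upwards [hint'.prod_right_ae] with Q hQ
  have hentry : ∀ j i k, Integrable (fun R : Fin J → Matrix (Fin n) (Fin n) ℝ => R j i k)
      (Measure.pi κ) ∧ ∫ R : Fin J → Matrix (Fin n) (Fin n) ℝ, R j i k ∂(Measure.pi κ) =
        c * (1 : Matrix (Fin n) (Fin n) ℝ) i k := by
    intro j i k
    have he := measurePreserving_eval κ j
    refine ⟨he.integrable_comp_of_integrable (hmean j i k).1, ?_⟩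
    rw [← (hmean j i k).2, ← he.map_eq, integral_map he.aemeasurable
      (he.map_eq ▸ (hmean j i k).1.aestronglyMeasurable)]
  have hterm : ∀ j i k a b, Integrable (fun R : Fin J → Matrix (Fin n) (Fin n) ℝ =>
      Q j i a * R j a b * A j b k) (Measure.pi κ) := fun j i k a b =>
    ((hentry j a b).1.const_mul _).mul_const _
  have hsum : ∀ (R : Fin J → Matrix (Fin n) (Fin n) ℝ) i k, (∑ j, Q j * R j * A j) i k =
      ∑ j, ∑ b, ∑ a, Q j i a * R j a b * A j b k := by
    intro R i k
    simp only [Matrix.sum_apply, Matrix.mul_apply, Finset.sum_mul]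
  have hJensen : Ψ (c • ∑ j, Q j * A j) ≤ ∫ R, Ψ (∑ j, Q j * R j * A j) ∂(Measure.pi κ) := by
    refine hΨ.map_integral_matrix_le (fun i k => ?_) hQ fun i k => ?_
    · simp only [hsum]
      exact integrable_finsetSum _ fun j _ => integrable_finsetSum _ fun b _ =>
        integrable_finsetSum _ fun a _ => hterm j i k a b
    · have hc1 : c • ∑ j, Q j * A j = ∑ j, Q j * (c • (1 : Matrix (Fin n) (Fin n) ℝ)) * A j := by
        simp [Finset.smul_sum]
      rw [hc1, hsum fun _ => c • (1 : Matrix (Fin n) (Fin n) ℝ)]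
      simp only [hsum]
      rw [integral_finsetSum _ fun j _ => integrable_finsetSum _ fun b _ =>
        integrable_finsetSum _ fun a _ => hterm j i k a b]
      refine Finset.sum_congr rfl fun j _ => ?_
      rw [integral_finsetSum _ fun b _ => integrable_finsetSum _ fun a _ => hterm j i k a b]
      refine Finset.sum_congr rfl fun b _ => ?_
      rw [integral_finsetSum _ fun a _ => hterm j i k a b]
      refine Finset.sum_congr rfl fun a _ => ?_
      rw [integral_mul_const, integral_const_mul, (hentry j a b).2]
      rfl
  refine le_trans (hΦ_mono ?_) hJensen
  rw [hN_hom c _ (by linarith)]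
  nlinarith [hN_nonneg (∑ j, Q j * A j)]
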